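/- The function v(α) = 1/α³ − cos(α)/sin³(α) is monotone nondecreasing on the interval (0, π/2); equivalently, its derivative v'(α) = −3/α⁴ + 1/sin²(α) + 3 cos²(α)/sin⁴(α) satisfies v'(α) ≥ 0 for all α ∈ (0, π/2). -/

import Mathlib

open Real

theorem nonneg_of_hasDerivAt_nonneg {f f' : ℝ → ℝ} (h_deriv : ∀ x, HasDerivAt f (f' x) x)
    (h_zero : f 0 = 0) (h_nonneg : ∀ x, 0 ≤ x → 0 ≤ f' x) {x : ℝ} (hx : 0 ≤ x) : 0 ≤ f x := by
  have h_mono : MonotoneOn f (Set.Ici 0) := by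
    refine monotoneOn_of_deriv_nonneg (convex_Ici 0)
      (fun y _ => (h_deriv y).continuousAt.continuousWithinAt)
      (fun y _ => (h_deriv y).differentiableAt.differentiableWithinAt) fun y hy => ?_
    rw [interior_Ici] at hy
    rw [(h_deriv y).deriv]
    exact h_nonneg y (le_of_lt hy)
  simpa [h_zero] using h_mono Set.self_mem_Ici hx hx

theorem cos_le_taylor_four {x : ℝ} (hx : 0 ≤ x) :
    Real.cos x ≤ 1 - x ^ 2 / 2 + x ^ 4 / 24 := by
  have h := nonneg_of_hasDerivAt_nonneg
    (f := fun y => 1 - y ^ 2 / 2 + y ^ 4 / 24 - Real.cos y)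
    (f' := fun y => Real.sin y - (y - y ^ 3 / 6))
    (fun y => by
      refine HasDerivAt.congr_deriv
        ((((hasDerivAt_const y (1 : ℝ)).sub ((hasDerivAt_pow 2 y).div_const 2)).add
          ((hasDerivAt_pow 4 y).div_const 24)).sub (Real.hasDerivAt_cos y)) ?_
      norm_num
      ring)
    (by simp) (fun y hy => sub_nonneg.2 (Real.sin_ge_sub_cube hy)) hx
  linarith

theorem sin_le_taylor_five {x : ℝ} (hx : 0 ≤ x) :
    Real.sin x ≤ x - x ^ 3 / 6 + x ^ 5 / 120 := by
  have h := nonneg_of_hasDerivAt_nonneg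
    (f := fun y => y - y ^ 3 / 6 + y ^ 5 / 120 - Real.sin y)
    (f' := fun y => 1 - y ^ 2 / 2 + y ^ 4 / 24 - Real.cos y)
    (fun y => by
      refine HasDerivAt.congr_deriv
        ((((hasDerivAt_id y).sub ((hasDerivAt_pow 3 y).div_const 6)).add
        ((hasDerivAt_pow 5 y).div_const 120)).sub (Real.hasDerivAt_sin y)) ?_
      norm_num
      ring)
    (by simp) (fun y hy => sub_nonneg.2 (cos_le_taylor_four hy)) hx
  linarith

theorem taylor_six_le_cos {x : ℝ} (hx : 0 ≤ x) :
    1 - x ^ 2 / 2 + x ^ 4 / 24 - x ^ 6 / 720 ≤ Real.cos x := by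
  have h := nonneg_of_hasDerivAt_nonneg
    (f := fun y => Real.cos y - (1 - y ^ 2 / 2 + y ^ 4 / 24 - y ^ 6 / 720))
    (f' := fun y => y - y ^ 3 / 6 + y ^ 5 / 120 - Real.sin y)
    (fun y => by
      refine HasDerivAt.congr_deriv
        ((Real.hasDerivAt_cos y).sub ((((hasDerivAt_const y (1 : ℝ)).sub
        ((hasDerivAt_pow 2 y).div_const 2)).add ((hasDerivAt_pow 4 y).div_const 24)).sub
        ((hasDerivAt_pow 6 y).div_const 720))) ?_
      norm_num
      ring)
    (by simp) (fun y hy => sub_nonneg.2 (sin_le_taylor_five hy)) hx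
  linarith

theorem sin_sq_le_taylor_six {x : ℝ} (hx : 0 ≤ x) :
    Real.sin x ^ 2 ≤ x ^ 2 - x ^ 4 / 3 + 2 * x ^ 6 / 45 := by
  have h := taylor_six_le_cos (x := 2 * x) (by positivity)
  rw [Real.cos_two_mul, Real.cos_sq'] at h
  linarith

theorem three_mul_sin_pow_four_le {x : ℝ} (hx : 0 ≤ x) (hx2 : x ≤ π / 2) :
    3 * Real.sin x ^ 4 ≤ x ^ 4 * (Real.sin x ^ 2 + 3 * Real.cos x ^ 2) := by
  have h := sin_sq_le_taylor_six hx
  have h_sq : x ^ 2 ≤ 3 := by nlinarith [Real.pi_lt_d2]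
  set u := x ^ 2 - x ^ 4 / 3 + 2 * x ^ 6 / 45 with hu
  have h_four : Real.sin x ^ 4 ≤ u ^ 2 := by
    have := pow_le_pow_left₀ (sq_nonneg (Real.sin x)) h 2
    rwa [← pow_mul] at this
  have h_poly : 3 * u ^ 2 ≤ x ^ 4 * (3 - 2 * u) := by
    have h_diff : x ^ 4 * (3 - 2 * u) - 3 * u ^ 2 =
        x ^ 8 * (1 / 15 - 4 * (x ^ 2) ^ 2 / 675) := by
      rw [hu]
      ring
    have : 0 ≤ x ^ 8 * (1 / 15 - 4 * (x ^ 2) ^ 2 / 675) :=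
      mul_nonneg (by positivity) (by nlinarith [sq_nonneg x])
    linarith
  have h_mul : x ^ 4 * (3 - 2 * u) ≤ x ^ 4 * (Real.sin x ^ 2 + 3 * Real.cos x ^ 2) := by
    refine mul_le_mul_of_nonneg_left ?_ (by positivity)
    rw [Real.cos_sq']
    linarith
  linarith

theorem hasDerivAt_one_div_cube_sub_cos_div_sin_cube {x : ℝ} (hx : x ≠ 0)
    (h_sin : Real.sin x ≠ 0) :
    HasDerivAt (fun α : ℝ => 1 / α ^ 3 - Real.cos α / (Real.sin α) ^ 3)
      (-3 / x ^ 4 + 1 / (Real.sin x) ^ 2 + 3 * (Real.cos x) ^ 2 / (Real.sin x) ^ 4) x := by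
  refine HasDerivAt.congr_deriv
    (((hasDerivAt_const x (1 : ℝ)).div (hasDerivAt_pow 3 x)
      (pow_ne_zero 3 hx)).sub
    ((Real.hasDerivAt_cos x).div ((Real.hasDerivAt_sin x).pow 3) (pow_ne_zero 3 h_sin))) ?_
  norm_num
  field_simp
  ring

/-- The function `v(α) = 1/α³ − cos α / sin³ α` is monotone nondecreasing on `(0, π/2)`;
equivalently, its derivative `v'(α) = −3/α⁴ + 1/sin²α + 3cos²α/sin⁴α` is nonnegative
there. -/
theorem v_monotoneOn_and_deriv_nonneg :
    MonotoneOn (fun α : ℝ => 1 / α ^ 3 - Real.cos α / (Real.sin α) ^ 3)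
        (Set.Ioo (0 : ℝ) (π / 2)) ∧
      ∀ α ∈ Set.Ioo (0 : ℝ) (π / 2),
        -3 / α ^ 4 + 1 / (Real.sin α) ^ 2 + 3 * (Real.cos α) ^ 2 / (Real.sin α) ^ 4 ≥ 0 := by
  have h_sin : ∀ α ∈ Set.Ioo (0 : ℝ) (π / 2), 0 < Real.sin α := fun α hα =>
    Real.sin_pos_of_pos_of_lt_pi hα.1 (by linarith [hα.2, Real.pi_pos])
  have h_nonneg : ∀ α ∈ Set.Ioo (0 : ℝ) (π / 2),
      -3 / α ^ 4 + 1 / (Real.sin α) ^ 2 + 3 * (Real.cos α) ^ 2 / (Real.sin α) ^ 4 ≥ 0 := by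
    intro α hα
    have hs := h_sin α hα
    have hα0 := hα.1
    have h_eq : -3 / α ^ 4 + 1 / (Real.sin α) ^ 2 + 3 * (Real.cos α) ^ 2 / (Real.sin α) ^ 4 =
        (α ^ 4 * (Real.sin α ^ 2 + 3 * Real.cos α ^ 2) - 3 * Real.sin α ^ 4) /
          (α ^ 4 * Real.sin α ^ 4) := by
      field_simp
      ring
    rw [h_eq]
    exact div_nonneg (sub_nonneg.2 (three_mul_sin_pow_four_le hα0.le hα.2.le)) (by positivity)
  have h_deriv := fun α (hα : α ∈ Set.Ioo (0 : ℝ) (π / 2)) =>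
    hasDerivAt_one_div_cube_sub_cos_div_sin_cube hα.1.ne' (h_sin α hα).ne'
  refine ⟨monotoneOn_of_deriv_nonneg (convex_Ioo _ _)
    (fun α hα => (h_deriv α hα).continuousAt.continuousWithinAt) ?_ ?_, h_nonneg⟩ <;>
    rw [interior_Ioo]
  · exact fun α hα => (h_deriv α hα).differentiableAt.differentiableWithinAt
  · intro α hα
    rw [(h_deriv α hα).deriv]
    exact h_nonneg α hα
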